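/- Fix an integer Δ ≥ 3. Every ζ = (β, γ, λ) ∈ ℝ³ with β > 0, γ > 0, βγ > Δ/(Δ−2), and λ > ((Δ−2)βγ−Δ)/(β·r^{Δ−1}) where r = min{1, 1/γ}, satisfies real contraction for Δ. -/

import Mathlib

open scoped Classical
open Finset

noncomputable section

/-- The tree recursion function `F_{ζ,s}(x) = λ β^{s₁} γ^{−s₂} ∏ᵢ (βxᵢ+1)/(xᵢ+γ)` (real). -/
def FrecR (ζ : ℝ × ℝ × ℝ) (s : ℕ × ℕ × ℕ) (x : Fin s.2.2 → ℝ) : ℝ :=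
  ζ.2.2 * ζ.1 ^ s.1 * (ζ.2.1)⁻¹ ^ s.2.1 * ∏ i, (ζ.1 * x i + 1) / (x i + ζ.2.1)
/-- `ζ = (β,γ,λ) ∈ ℝ³` satisfies real contraction for `Δ`: there are a compact interval
`J = [a,b]` with `λ ∈ J`, `−γ ∉ J`, `−1 ∉ J`, and a real analytic `φ` on `J` with
nonvanishing derivative (with inverse `ψ` on `I = φ(J)`), such that `J` is invariant
under all recursion functions with `‖s‖₁ ≤ Δ−1`, the value `−1` is avoided for
`‖s‖₁ = Δ`, and the `1`-norm of the gradient of `φ ∘ F_{ζ,s} ∘ ψ` is at most `1 − η`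
on `I^k` for some `η > 0`. -/
def RealContraction (ζ : ℝ × ℝ × ℝ) (Δ : ℕ) : Prop :=
  ∃ (a b : ℝ) (φ ψ : ℝ → ℝ) (η : ℝ),
    a ≤ b ∧ ζ.2.2 ∈ Set.Icc a b ∧ -ζ.2.1 ∉ Set.Icc a b ∧ (-1:ℝ) ∉ Set.Icc a b ∧
    AnalyticOnNhd ℝ φ (Set.Icc a b) ∧
    (∀ x ∈ Set.Icc a b, deriv φ x ≠ 0) ∧
    (∀ x ∈ Set.Icc a b, ψ (φ x) = x) ∧
    (∀ y ∈ φ '' Set.Icc a b, φ (ψ y) = y) ∧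
    (∀ s : ℕ × ℕ × ℕ, s.1 + s.2.1 + s.2.2 ≤ Δ - 1 →
      ∀ x : Fin s.2.2 → ℝ, (∀ i, x i ∈ Set.Icc a b) → FrecR ζ s x ∈ Set.Icc a b) ∧
    (∀ s : ℕ × ℕ × ℕ, s.1 + s.2.1 + s.2.2 = Δ →
      ∀ x : Fin s.2.2 → ℝ, (∀ i, x i ∈ Set.Icc a b) → FrecR ζ s x ≠ -1) ∧
    0 < η ∧
    (∀ s : ℕ × ℕ × ℕ, s.1 + s.2.1 + s.2.2 ≤ Δ - 1 →
      ∀ x : Fin s.2.2 → ℝ, (∀ i, x i ∈ φ '' Set.Icc a b) →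
        ∑ i, |deriv (fun t => φ (FrecR ζ s fun j => ψ (Function.update x i t j))) (x i)|
          ≤ 1 - η)

theorem mobius_bounds {β γ x : ℝ} (hγ : 0 < γ) (hβγ : 1 ≤ β * γ) (hx : 0 ≤ x) :
    γ⁻¹ ≤ (β * x + 1) / (x + γ) ∧ (β * x + 1) / (x + γ) ≤ β := by
  constructor
  · rw [inv_eq_one_div, div_le_div_iff₀ hγ (by positivity)]
    nlinarith
  · rw [div_le_iff₀ (by positivity)]
    nlinarith

theorem FrecR_pos {β γ lam : ℝ} (hβ : 0 < β) (hγ : 0 < γ) (hlam : 0 < lam) (s : ℕ × ℕ × ℕ)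
    {x : Fin s.2.2 → ℝ} (hx : ∀ i, 0 ≤ x i) : 0 < FrecR (β, γ, lam) s x := by
  have h : 0 < ∏ i, (β * x i + 1) / (x i + γ) :=
    Finset.prod_pos fun i _ => by have := hx i; positivity
  simp only [FrecR]
  positivity

theorem FrecR_mem_Icc {β γ lam : ℝ} (hβ : 0 < β) (hγ : 0 < γ) (hβγ : 1 ≤ β * γ)
    (hlam : 0 < lam) {n : ℕ} {s : ℕ × ℕ × ℕ} (hs : s.1 + s.2.1 + s.2.2 ≤ n)
    {x : Fin s.2.2 → ℝ} (hx : ∀ i, 0 ≤ x i) :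
    FrecR (β, γ, lam) s x ∈ Set.Icc (lam * min 1 γ⁻¹ ^ n) (lam * max 1 β ^ n) := by
  have hγβ : γ⁻¹ ≤ β := by rw [inv_eq_one_div, div_le_iff₀ hγ]; exact hβγ
  have hr : 0 < min 1 γ⁻¹ := lt_min one_pos (inv_pos.2 hγ)
  have hr1 : min 1 γ⁻¹ ≤ 1 := min_le_left _ _
  have hM1 : 1 ≤ max 1 β := le_max_left _ _
  have hp1 : min 1 γ⁻¹ ^ s.2.2 ≤ ∏ i, (β * x i + 1) / (x i + γ) := by
    have := Finset.prod_le_prod (s := Finset.univ) (f := fun _ : Fin s.2.2 => min 1 γ⁻¹)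
      (g := fun i => (β * x i + 1) / (x i + γ)) (fun _ _ => hr.le)
      (fun i _ => (min_le_right _ _).trans (mobius_bounds hγ hβγ (hx i)).1)
    simpa using this
  have hp2 : ∏ i, (β * x i + 1) / (x i + γ) ≤ max 1 β ^ s.2.2 := by
    have := Finset.prod_le_prod (s := Finset.univ) (g := fun _ : Fin s.2.2 => max 1 β)
      (f := fun i => (β * x i + 1) / (x i + γ))
      (fun i _ => (inv_pos.2 hγ).le.trans (mobius_bounds hγ hβγ (hx i)).1)
      (fun i _ => (mobius_bounds hγ hβγ (hx i)).2.trans (le_max_right _ _))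
    simpa using this
  have hp0 : 0 ≤ ∏ i, (β * x i + 1) / (x i + γ) := (pow_pos hr _).le.trans hp1
  simp only [FrecR]
  constructor
  · calc lam * min 1 γ⁻¹ ^ n ≤ lam * min 1 γ⁻¹ ^ (s.1 + s.2.1 + s.2.2) := by
          exact mul_le_mul_of_nonneg_left (pow_le_pow_of_le_one hr.le hr1 hs) hlam.le
      _ = lam * min 1 γ⁻¹ ^ s.1 * min 1 γ⁻¹ ^ s.2.1 * min 1 γ⁻¹ ^ s.2.2 := by ring
      _ ≤ _ := by
          gcongr
          · exact (min_le_right _ _).trans hγβ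
          · exact min_le_right _ _
  · calc _ ≤ lam * max 1 β ^ s.1 * max 1 β ^ s.2.1 * max 1 β ^ s.2.2 := by
          gcongr
          · exact le_max_right _ _
          · exact hγβ.trans (le_max_right _ _)
      _ = lam * max 1 β ^ (s.1 + s.2.1 + s.2.2) := by ring
      _ ≤ lam * max 1 β ^ n := by
          exact mul_le_mul_of_nonneg_left (pow_le_pow_right₀ hM1 hs) hlam.le

theorem hasDerivAt_log_mobius_exp {β γ : ℝ} (hβ : 0 < β) (hγ : 0 < γ) (t : ℝ) :
    HasDerivAt (fun t => Real.log ((β * Real.exp t + 1) / (Real.exp t + γ)))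
      ((β * γ - 1) * Real.exp t / ((β * Real.exp t + 1) * (Real.exp t + γ))) t := by
  have he := Real.exp_pos t
  have h1 : 0 < β * Real.exp t + 1 := by positivity
  have h2 : 0 < Real.exp t + γ := by positivity
  have h := ((((Real.hasDerivAt_exp t).const_mul β).add_const 1).div
    ((Real.hasDerivAt_exp t).add_const γ) h2.ne').log (div_pos h1 h2).ne'
  refine h.congr_deriv ?_
  simp only [Pi.div_apply]
  field_simp
  ring

theorem deriv_log_FrecR_exp {β γ lam : ℝ} (hβ : 0 < β) (hγ : 0 < γ) (hlam : 0 < lam)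
    (s : ℕ × ℕ × ℕ) (x : Fin s.2.2 → ℝ) (i : Fin s.2.2) :
    deriv (fun t => Real.log
        (FrecR (β, γ, lam) s fun j => Real.exp (Function.update x i t j))) (x i) =
      (β * γ - 1) * Real.exp (x i) / ((β * Real.exp (x i) + 1) * (Real.exp (x i) + γ)) := by
  set K : ℝ := lam * β ^ s.1 * γ⁻¹ ^ s.2.1 *
    ∏ j ∈ Finset.univ.erase i, (β * Real.exp (x j) + 1) / (Real.exp (x j) + γ) with hK
  have hK0 : 0 < K := by
    have : 0 < ∏ j ∈ Finset.univ.erase i, (β * Real.exp (x j) + 1) / (Real.exp (x j) + γ) :=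
      Finset.prod_pos fun j _ => by positivity
    positivity
  have hF : (fun t => Real.log
      (FrecR (β, γ, lam) s fun j => Real.exp (Function.update x i t j))) =
      fun t => Real.log K + Real.log ((β * Real.exp t + 1) / (Real.exp t + γ)) := by
    funext t
    rw [← Real.log_mul hK0.ne' (by positivity)]
    congr 1
    simp only [FrecR]
    rw [← Finset.mul_prod_erase _ _ (Finset.mem_univ i), Function.update_self, hK,
      Finset.prod_congr rfl fun j hj => by rw [Function.update_of_ne (Finset.ne_of_mem_erase hj)]]
    ring
  rw [hF]
  exact ((hasDerivAt_log_mobius_exp hβ hγ (x i)).const_add _).deriv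

theorem mul_mobius_log_deriv_le {β γ x b c k : ℝ} (hβ : 0 < β) (hγ : 0 < γ)
    (hβγ : 1 ≤ β * γ) (hx : 0 < x) (hxb : x ≤ b) (hkc : k ≤ c)
    (hxc : (c - 1) * (β * γ) - (c + 1) ≤ β * x) :
    k * ((β * γ - 1) * x / ((β * x + 1) * (x + γ))) ≤ 1 - γ / ((β * b + 1) * (b + γ)) := by
  have hb : 0 < b := hx.trans_le hxb
  have h1 : γ / ((β * b + 1) * (b + γ)) ≤ γ / ((β * x + 1) * (x + γ)) := by gcongr
  have h0 : 0 ≤ (β * γ - 1) * x / ((β * x + 1) * (x + γ)) :=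
    div_nonneg (mul_nonneg (by linarith) hx.le) (by positivity)
  have h2 : c * ((β * γ - 1) * x / ((β * x + 1) * (x + γ))) ≤
      1 - γ / ((β * x + 1) * (x + γ)) := by
    rw [le_sub_iff_add_le, ← mul_div_assoc, ← add_div, div_le_one (by positivity)]
    nlinarith [mul_nonneg hx.le (sub_nonneg.2 hxc)]
  linarith [mul_le_mul_of_nonneg_right hkc h0]

/-- For `Δ ≥ 3`, every `ζ = (β, γ, λ) ∈ ℝ³` with `β, γ > 0`,
`βγ > Δ/(Δ−2)`, and `λ > ((Δ−2)βγ−Δ)/(β·r^{Δ−1})` where `r = min{1, 1/γ}`,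
satisfies real contraction for `Δ`. -/
theorem S4_realContraction (Δ : ℕ) (hΔ : 3 ≤ Δ) (β γ lam : ℝ)
    (hβ : 0 < β) (hγ : 0 < γ)
    (hβγ : β * γ > (Δ:ℝ) / ((Δ:ℝ) - 2))
    (hlam : lam > (((Δ:ℝ) - 2) * (β * γ) - (Δ:ℝ)) / (β * (min 1 γ⁻¹) ^ (Δ - 1))) :
    RealContraction (β, γ, lam) Δ := by
  have hΔ' : (3 : ℝ) ≤ Δ := by exact_mod_cast hΔ
  have hcast : ((Δ - 1 : ℕ) : ℝ) = Δ - 1 := by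
    rw [Nat.cast_sub (by omega), Nat.cast_one]
  have hgap : (Δ : ℝ) < ((Δ : ℝ) - 2) * (β * γ) := by
    rw [gt_iff_lt, div_lt_iff₀ (by linarith)] at hβγ
    linarith
  have hβγ1 : 1 ≤ β * γ := by nlinarith
  have hr : 0 < min 1 γ⁻¹ := lt_min one_pos (inv_pos.2 hγ)
  have hrn : 0 < min 1 γ⁻¹ ^ (Δ - 1) := pow_pos hr _
  have hlam0 : 0 < lam := by
    refine lt_trans ?_ hlam
    exact div_pos (by linarith) (by positivity)
  set a := lam * min 1 γ⁻¹ ^ (Δ - 1) with ha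
  set b := lam * max 1 β ^ (Δ - 1) with hb
  have ha0 : 0 < a := by positivity
  have hβa : ((Δ : ℝ) - 2) * (β * γ) - Δ < β * a := by
    rw [gt_iff_lt, div_lt_iff₀ (by positivity)] at hlam
    rw [ha]
    linarith
  have hla : a ≤ lam :=
    mul_le_of_le_one_right hlam0.le (pow_le_one₀ hr.le (min_le_left _ _))
  have hlb : lam ≤ b :=
    le_mul_of_one_le_right hlam0.le (one_le_pow₀ (le_max_left _ _))
  have hb0 : 0 < b := hlam0.trans_le hlb
  have hpos : ∀ x ∈ Set.Icc a b, 0 < x := fun x hx => ha0.trans_le hx.1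
  refine ⟨a, b, Real.log, Real.exp, γ / ((β * b + 1) * (b + γ)), hla.trans hlb, ⟨hla, hlb⟩,
    fun h => ?_, fun h => ?_, fun x hx => analyticAt_log (hpos x hx), fun x hx => ?_,
    fun x hx => Real.exp_log (hpos x hx), fun y _ => Real.log_exp y,
    fun s hs x hx => ?_, fun s _ x hx => ?_, by positivity, fun s hs x hx => ?_⟩
  · have := hpos _ h
    simp only at this
    linarith
  · have := hpos _ h
    linarith
  · rw [Real.deriv_log]
    exact inv_ne_zero (hpos x hx).ne'
  · exact FrecR_mem_Icc hβ hγ hβγ1 hlam0 hs fun i => (hpos _ (hx i)).le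
  · have := FrecR_pos hβ hγ hlam0 s fun i => (hpos _ (hx i)).le
    linarith
  · have hexp : ∀ i, Real.exp (x i) ∈ Set.Icc a b := fun i => by
      obtain ⟨z, hz, hzi⟩ := hx i
      rw [← hzi, Real.exp_log (hpos z hz)]
      exact hz
    have hterm : ∀ i, (s.2.2 : ℝ) * |deriv (fun t => Real.log
        (FrecR (β, γ, lam) s fun j => Real.exp (Function.update x i t j))) (x i)| ≤
          1 - γ / ((β * b + 1) * (b + γ)) := fun i => by
      have he := Real.exp_pos (x i)
      rw [deriv_log_FrecR_exp hβ hγ hlam0, abs_of_nonneg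
        (div_nonneg (mul_nonneg (by linarith) he.le) (by positivity))]
      refine mul_mobius_log_deriv_le (c := Δ - 1) hβ hγ hβγ1 he (hexp i).2 ?_ ?_
      · rw [← hcast]
        exact_mod_cast (by omega : s.2.2 ≤ Δ - 1)
      · have := mul_le_mul_of_nonneg_left (hexp i).1 hβ.le
        linarith
    rcases Nat.eq_zero_or_pos s.2.2 with h0 | h0
    · have : IsEmpty (Fin s.2.2) := by rw [h0]; infer_instance
      rw [Finset.univ_eq_empty, Finset.sum_empty, sub_nonneg, div_le_one (by positivity)]
      nlinarith [mul_pos hβ hb0, mul_pos (mul_pos hβ hb0) hγ, mul_pos (mul_pos hβ hb0) hb0]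
    · have hk : (0 : ℝ) < s.2.2 := by exact_mod_cast h0
      refine (Finset.sum_le_card_nsmul _ _ ((1 - γ / ((β * b + 1) * (b + γ))) / s.2.2)
        fun i _ => ?_).trans_eq ?_
      · rw [le_div_iff₀ hk, mul_comm]
        exact hterm i
      · rw [Finset.card_univ, Fintype.card_fin, nsmul_eq_mul, mul_div_cancel₀ _ hk.ne']
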